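/- Let R be a ring and I a nil ideal of R (every element of I is nilpotent). Then R is a UWNC ring if and only if the quotient ring R/I is a UWNC ring. -/

import Mathlib

/-- An element of a ring is *weakly nil-clean* if it is `e + n` or `-e + n`
for an idempotent `e` and a nilpotent `n`. -/
def IsWeaklyNilClean {R : Type*} [Ring R] (a : R) : Prop :=
  ∃ e n : R, IsIdempotentElem e ∧ IsNilpotent n ∧ (a = e + n ∨ a = -e + n)

/-- An element of a ring is *nil-clean* if it is `e + n`
for an idempotent `e` and a nilpotent `n`. -/
def IsNilClean {R : Type*} [Ring R] (a : R) : Prop :=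
  ∃ e n : R, IsIdempotentElem e ∧ IsNilpotent n ∧ a = e + n

/-- A ring is *UWNC* if every unit is weakly nil-clean. -/
def IsUWNC (R : Type*) [Ring R] : Prop :=
  ∀ u : Rˣ, IsWeaklyNilClean (u : R)

/-- A ring is *UNC* if every unit is nil-clean. -/
def IsUNC (R : Type*) [Ring R] : Prop :=
  ∀ u : Rˣ, IsNilClean (u : R)

/-- A ring is *WUU* if every unit is of the form `n + 1` or `n - 1`
for a nilpotent `n`. -/
def IsWUU (R : Type*) [Ring R] : Prop :=
  ∀ u : Rˣ, ∃ n : R, IsNilpotent n ∧ ((u : R) = n + 1 ∨ (u : R) = n - 1)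

theorem RingHom.isUnit_of_isUnit_map_of_ker_isNilpotent {R S : Type*} [Ring R] [Ring S]
    (f : R →+* S) (hf : Function.Surjective f) (h : ∀ x ∈ RingHom.ker f, IsNilpotent x)
    {a : R} (ha : IsUnit (f a)) : IsUnit a := by
  have key : ∀ x : R, f x = 1 → IsUnit x := fun x hx ↦ by
    have hn : IsNilpotent (x - 1) := h _ (by simp [RingHom.mem_ker, hx])
    simpa using hn.isUnit_add_one
  obtain ⟨u, hu⟩ := ha
  obtain ⟨b, hb⟩ := hf ↑u⁻¹
  obtain ⟨v, hv⟩ := key (a * b) (by rw [map_mul, ← hu, hb, u.mul_inv])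
  obtain ⟨w, hw⟩ := key (b * a) (by rw [map_mul, ← hu, hb, u.inv_mul])
  refine isUnit_iff_exists_and_exists.2 ⟨⟨b * ↑v⁻¹, ?_⟩, ⟨↑w⁻¹ * b, ?_⟩⟩
  · rw [← mul_assoc, ← hv, v.mul_inv]
  · rw [mul_assoc, ← hw, w.inv_mul]

theorem RingHom.isNilpotent_of_isNilpotent_map_of_ker_isNilpotent {R S : Type*} [Ring R] [Ring S]
    (f : R →+* S) (h : ∀ x ∈ RingHom.ker f, IsNilpotent x)
    {a : R} (ha : IsNilpotent (f a)) : IsNilpotent a := by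
  obtain ⟨n, hn⟩ := ha
  exact (h (a ^ n) (by rw [RingHom.mem_ker, map_pow, hn])).of_pow

theorem IsWeaklyNilClean.map {R S : Type*} [Ring R] [Ring S] (f : R →+* S) {a : R}
    (ha : IsWeaklyNilClean a) : IsWeaklyNilClean (f a) := by
  obtain ⟨e, n, he, hn, h⟩ := ha
  refine ⟨f e, f n, he.map f, hn.map f, h.imp ?_ ?_⟩ <;> rintro rfl <;> simp

theorem IsWeaklyNilClean.of_map {R S : Type*} [Ring R] [Ring S] (f : R →+* S)
    (hf : Function.Surjective f) (h : ∀ x ∈ RingHom.ker f, IsNilpotent x) {a : R}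
    (ha : IsWeaklyNilClean (f a)) : IsWeaklyNilClean a := by
  obtain ⟨e', n, he', hn, ha⟩ := ha
  obtain ⟨e, he, rfl⟩ :=
    exists_isIdempotentElem_eq_of_ker_isNilpotent f h e' (hf e') he'
  rcases ha with ha | ha
  · refine ⟨e, a - e, he, f.isNilpotent_of_isNilpotent_map_of_ker_isNilpotent h ?_, .inl (by abel)⟩
    simpa [ha] using hn
  · refine ⟨e, a + e, he, f.isNilpotent_of_isNilpotent_map_of_ker_isNilpotent h ?_, .inr (by abel)⟩
    have : f (a + e) = n := by rw [map_add, ha]; abel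
    rwa [this]

theorem isUWNC_iff_of_surjective_of_ker_isNilpotent {R S : Type*} [Ring R] [Ring S] (f : R →+* S)
    (hf : Function.Surjective f) (h : ∀ x ∈ RingHom.ker f, IsNilpotent x) :
    IsUWNC R ↔ IsUWNC S := by
  refine ⟨fun hR u ↦ ?_, fun hS u ↦ .of_map f hf h (hS (Units.map (f : R →* S) u))⟩
  obtain ⟨a, ha⟩ := hf u
  obtain ⟨v, rfl⟩ := f.isUnit_of_isUnit_map_of_ker_isNilpotent hf h (ha ▸ u.isUnit)
  exact ha ▸ (hR v).map f

theorem isUWNC_iff_quotient_nil_ideal {R : Type*} [Ring R] (I : TwoSidedIdeal R)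
    (hI : ∀ x ∈ I, IsNilpotent x) :
    IsUWNC R ↔ IsUWNC I.ringCon.Quotient := by
  refine isUWNC_iff_of_surjective_of_ker_isNilpotent I.ringCon.mk' I.ringCon.mk'_surjective
    fun x hx ↦ hI x ?_
  rw [TwoSidedIdeal.mem_iff, ← RingCon.eq]
  exact hx
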